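/- Let n ≥ 1, 0 ≤ k ≤ n, and s ≥ 1. Then P_s^-Λ^k(S^n) = *_{S^n}P_{s-1}Λ^{n-k}(S^n); that is, the space P_s^-Λ^k(S^n) equals the image of P_{s-1}Λ^{n-k}(S^n) under the Hodge star *_{S^n}. -/

import Mathlib

open scoped BigOperators
open MeasureTheory

noncomputable section

/-- Vectors in `ℝ^m`. -/
abbrev Vec (m : ℕ) := Fin m → ℝ

/-- Differential `k`-forms on `ℝ^m`, given pointwise as alternating `k`-tensors. -/
abbrev Form (m k : ℕ) := Vec m → (Vec m [⋀^Fin k]→ₗ[ℝ] ℝ)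

/-- A multivariate polynomial has (total) degree at most `r : ℤ`. -/
def degLE {m : ℕ} (r : ℤ) (p : MvPolynomial (Fin m) ℝ) : Prop :=
  ∀ d ∈ p.support, ((d.sum fun _ e => e : ℕ) : ℤ) ≤ r

/-- `P_rΛ^k(ℝ^m)`: differential `k`-forms with polynomial coefficients of degree at most `r`. -/
def PL (m k : ℕ) (r : ℤ) : Set (Form m k) :=
  {α | ∀ v : Fin k → Vec m, ∃ p : MvPolynomial (Fin m) ℝ,
      degLE r p ∧ ∀ x, α x v = MvPolynomial.eval x p}

/-- Interior product with the radial vector field `X = Σ xᵢ ∂/∂xᵢ`. -/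
def iU {m k : ℕ} (β : Form m (k + 1)) : Form m k := fun x => (β x).curryLeft x

/-- `P_r⁻Λ^k(ℝ^m) := i_X P_{r-1}Λ^{k+1}(ℝ^m)`. -/
def PLm (m k : ℕ) (r : ℤ) : Set (Form m k) := iU '' PL m (k + 1) (r - 1)

/-- The reflection negating the `i`-th coordinate, as a map. -/
def reflFun (m : ℕ) (i : Fin m) (u : Vec m) : Vec m := fun j => if j = i then -u j else u j

/-- The reflection negating the `i`-th coordinate, as a linear map. -/
def reflLin (m : ℕ) (i : Fin m) : Vec m →ₗ[ℝ] Vec m :=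
  LinearMap.pi fun j => if j = i then -LinearMap.proj j else LinearMap.proj j

/-- Pullback of an ambient form along the reflection `R_i`. -/
def reflPull (m k : ℕ) (i : Fin m) (α : Form m k) : Form m k :=
  fun x => (α (reflFun m i x)).compLinearMap (reflLin m i)

/-- A form on `ℝ^m` is even if it is invariant under all coordinate reflections. -/
def IsEven (m k : ℕ) (α : Form m k) : Prop := ∀ i, reflPull m k i α = α

/-- A form on `ℝ^m` is odd if every coordinate reflection negates it. -/
def IsOdd (m k : ℕ) (α : Form m k) : Prop := ∀ i, reflPull m k i α = -α

/-- The map `Φ(u) = (u₁², …, u_m²)`. -/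
def Phi (m : ℕ) (u : Vec m) : Vec m := fun i => u i ^ 2

/-- The differential of `Φ` at `u`. -/
def dPhi (m : ℕ) (u : Vec m) : Vec m →ₗ[ℝ] Vec m :=
  LinearMap.pi fun i => (2 * u i) • LinearMap.proj i

/-- Pullback of ambient forms along `Φ`. -/
def phiPull (m k : ℕ) (α : Form m k) : Form m k :=
  fun u => (α (Phi m u)).compLinearMap (dPhi m u)

/-- The standard simplex `T^{m-1} ⊂ ℝ^m`. -/
def simplexSet (m : ℕ) : Set (Vec m) := {x | (∀ i, 0 ≤ x i) ∧ ∑ i, x i = 1}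

/-- The unit sphere `S^{m-1} ⊂ ℝ^m`. -/
def sphereSet (m : ℕ) : Set (Vec m) := {u | ∑ i, u i ^ 2 = 1}

/-- The linear functional `v ↦ ⟨u, v⟩`. -/
def dotLin (m : ℕ) (u : Vec m) : Vec m →ₗ[ℝ] ℝ := ∑ i, u i • LinearMap.proj i

/-- Orthogonal projection onto the tangent space of the sphere at `u`. -/
def projSph (m : ℕ) (u : Vec m) : Vec m →ₗ[ℝ] Vec m :=
  LinearMap.id - (dotLin m u).smulRight u

/-- The linear functional `v ↦ Σ vᵢ`. -/
def sumLin (m : ℕ) : Vec m →ₗ[ℝ] ℝ := ∑ i, LinearMap.proj i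

/-- Orthogonal projection onto the tangent hyperplane `{Σ vᵢ = 0}` of the simplex. -/
def projSim (m : ℕ) : Vec m →ₗ[ℝ] Vec m :=
  LinearMap.id - ((m : ℝ)⁻¹ • sumLin m).smulRight (fun _ => 1)

/-- Differential `k`-forms on a subset `M ⊆ ℝ^m`, encoded at each point by the canonical
alternating tensor on `ℝ^m` that vanishes in the directions normal to `M` (i.e. the
pullback along the inclusion, extended by the tangent projection). -/
abbrev FormOn (m : ℕ) (M : Set (Vec m)) (k : ℕ) := M → (Vec m [⋀^Fin k]→ₗ[ℝ] ℝ)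

/-- Restriction (pullback along the inclusion) of an ambient form to the simplex. -/
def resSim (m k : ℕ) (α : Form m k) : FormOn m (simplexSet m) k :=
  fun x => (α x.1).compLinearMap (projSim m)

/-- Restriction (pullback along the inclusion) of an ambient form to the sphere. -/
def resSph (m k : ℕ) (α : Form m k) : FormOn m (sphereSet m) k :=
  fun u => (α u.1).compLinearMap (projSph m u.1)

/-- `P_rΛ^k(T^{m-1})`. -/
def PLsim (m k : ℕ) (r : ℤ) : Set (FormOn m (simplexSet m) k) := resSim m k '' PL m k r

/-- `P_rΛ^k(S^{m-1})`. -/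
def PLsph (m k : ℕ) (r : ℤ) : Set (FormOn m (sphereSet m) k) := resSph m k '' PL m k r

/-- `P_r⁻Λ^k(T^{m-1})`. -/
def PLmsim (m k : ℕ) (r : ℤ) : Set (FormOn m (simplexSet m) k) := resSim m k '' PLm m k r

/-- `P_r⁻Λ^k(S^{m-1})`. -/
def PLmsph (m k : ℕ) (r : ℤ) : Set (FormOn m (sphereSet m) k) := resSph m k '' PLm m k r

lemma phi_mem_simplex {m : ℕ} {u : Vec m} (hu : u ∈ sphereSet m) :
    Phi m u ∈ simplexSet m :=
  ⟨fun _ => sq_nonneg _, hu⟩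

/-- Pullback `Φ^* : Λ^k(T^{m-1}) → Λ^k(S^{m-1})` along `Φ : S^{m-1} → T^{m-1}`. -/
def phiPullTS (m k : ℕ) (a : FormOn m (simplexSet m) k) : FormOn m (sphereSet m) k :=
  fun u => (a ⟨Phi m u.1, phi_mem_simplex u.2⟩).compLinearMap
    ((dPhi m u.1).comp (projSph m u.1))

lemma refl_mem_sphere {m : ℕ} {i : Fin m} {u : Vec m} (hu : u ∈ sphereSet m) :
    reflFun m i u ∈ sphereSet m := by
  have : ∀ j, (reflFun m i u j) ^ 2 = u j ^ 2 := by
    intro j; simp only [reflFun]; split <;> ring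
  simpa only [sphereSet, Set.mem_setOf_eq, this] using hu

/-- Pullback of a form on the sphere along the reflection `R_i`. -/
def reflPullSph (m k : ℕ) (i : Fin m) (α : FormOn m (sphereSet m) k) :
    FormOn m (sphereSet m) k :=
  fun u => (α ⟨reflFun m i u.1, refl_mem_sphere u.2⟩).compLinearMap (reflLin m i)

/-- A form on the sphere is even if it is invariant under all coordinate reflections. -/
def IsEvenSph (m k : ℕ) (α : FormOn m (sphereSet m) k) : Prop :=
  ∀ i, reflPullSph m k i α = α

/-- A form on the sphere is odd if every coordinate reflection negates it. -/
def IsOddSph (m k : ℕ) (α : FormOn m (sphereSet m) k) : Prop :=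
  ∀ i, reflPullSph m k i α = -α

/-- The bubble function `u_N = u₁ ⋯ u_m`. -/
def bubble (m : ℕ) (u : Vec m) : ℝ := ∏ i, u i

/-- Multiplication of a form on the sphere by the bubble function. -/
def bubbleSmul (m k : ℕ) (α : FormOn m (sphereSet m) k) : FormOn m (sphereSet m) k :=
  fun u => bubble m u.1 • α u

/-- Multiplication of an ambient form by the bubble function. -/
def bubbleSmulAmb (m k : ℕ) (α : Form m k) : Form m k :=
  fun u => bubble m u • α u

/-- The standard volume form on `ℝ^m`. -/
def volForm (m : ℕ) : (Vec m) [⋀^Fin m]→ₗ[ℝ] ℝ := (Pi.basisFun ℝ (Fin m)).det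

/-- Iterated interior product: insert the vectors `v 0, …, v (k-1)` into the
first `k` slots of an alternating `(k+j)`-tensor. -/
def contrMany {m : ℕ} : (k : ℕ) → (Fin k → Vec m) → {j : ℕ} →
    ((Vec m) [⋀^Fin (k + j)]→ₗ[ℝ] ℝ) → ((Vec m) [⋀^Fin j]→ₗ[ℝ] ℝ)
  | 0, _, j, α => α.domDomCongr (finCongr (Nat.zero_add j))
  | (k + 1), v, j, α =>
      contrMany k (fun i => v i.succ)
        ((α.domDomCongr (finCongr (by omega : (k + 1) + j = (k + j) + 1))).curryLeft (v 0))

/-- The Hodge star on alternating tensors on `ℝ^m` (standard metric and orientation):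
`(⋆α)(w₁,…,w_{m-k}) = (1/k!) Σ_g α(e_{g 0},…,e_{g(k-1)}) vol(e_{g 0},…,e_{g(k-1)},w₁,…,w_{m-k})`. -/
def starAlt (m k : ℕ) (α : (Vec m) [⋀^Fin k]→ₗ[ℝ] ℝ) : (Vec m) [⋀^Fin (m - k)]→ₗ[ℝ] ℝ :=
  if h : k ≤ m then
    (k.factorial : ℝ)⁻¹ •
      ∑ g : Fin k → Fin m,
        α (fun i => Pi.single (g i) 1) •
          contrMany k (fun i => Pi.single (g i) 1)
            ((volForm m).domDomCongr (finCongr (by omega : m = k + (m - k))))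
  else 0

/-- The Hodge star `⋆_{ℝ^m}` applied pointwise to ambient forms. -/
def starR (m k : ℕ) (α : Form m k) : Form m (m - k) := fun x => starAlt m k (α x)

/-- The wedge product of alternating tensors. -/
def wedgeAlt {m k l : ℕ} (α : (Vec m) [⋀^Fin k]→ₗ[ℝ] ℝ) (β : (Vec m) [⋀^Fin l]→ₗ[ℝ] ℝ) :
    (Vec m) [⋀^Fin (k + l)]→ₗ[ℝ] ℝ :=
  ((TensorProduct.lid ℝ ℝ).toLinearMap.compAlternatingMap (α.domCoprod β)).domDomCongr
    finSumFinEquiv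

/-- The conormal `ν = Σ uᵢ duᵢ` at `u`, as an alternating 1-tensor. -/
def nuForm (m : ℕ) (u : Vec m) : (Vec m) [⋀^Fin 1]→ₗ[ℝ] ℝ :=
  AlternatingMap.ofSubsingleton ℝ (Vec m) ℝ (0 : Fin 1) (dotLin m u)

/-- The extended Hodge star `⋆_{S^{m-1}} α := ⋆_{ℝ^m}(ν ∧ α)` on ambient forms. -/
def starSphAmb (m k : ℕ) (α : Form m k) : Form m (m - (1 + k)) :=
  fun x => starAlt m (1 + k) (wedgeAlt (nuForm m x) (α x))

/-- The Hodge star of a form on the sphere (w.r.t. the round metric and the orientation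
induced by the outward normal), computed as the restriction of `⋆_{ℝ^m}(ν ∧ ·)`. -/
def starSph (m k : ℕ) (α : FormOn m (sphereSet m) k) :
    FormOn m (sphereSet m) (m - (1 + k)) :=
  fun u => (starAlt m (1 + k) (wedgeAlt (nuForm m u.1) (α u))).compLinearMap (projSph m u.1)

/-- Re-indexing a form along an equality of form degrees. -/
def castForm {m k l : ℕ} (h : k = l) (α : Form m k) : Form m l :=
  fun x => (α x).domDomCongr (finCongr h)

/-- Re-indexing a form on a subset along an equality of form degrees. -/
def castFormOn {m : ℕ} {M : Set (Vec m)} {k l : ℕ} (h : k = l) (α : FormOn m M k) :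
    FormOn m M l :=
  fun x => (α x).domDomCongr (finCongr h)

/-- Trace on the boundary of the simplex vanishes: at every boundary point (a point of some
face `xᵢ = 0`), the form vanishes on vectors tangent to that face. -/
def vanishBdry (m k : ℕ) (a : FormOn m (simplexSet m) k) : Prop :=
  ∀ (x : simplexSet m) (i : Fin m), x.1 i = 0 →
    ∀ v : Fin k → Vec m, (∀ j, (∑ l, v j l) = 0 ∧ v j i = 0) → a x v = 0

/-- `P̊_rΛ^k(T^{m-1})`: forms in `P_rΛ^k(T^{m-1})` with vanishing trace on the boundary. -/
def PLosim (m k : ℕ) (r : ℤ) : Set (FormOn m (simplexSet m) k) :=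
  {a ∈ PLsim m k r | vanishBdry m k a}

/-- `P̊_r⁻Λ^k(T^{m-1})`. -/
def PLmosim (m k : ℕ) (r : ℤ) : Set (FormOn m (simplexSet m) k) :=
  {a ∈ PLmsim m k r | vanishBdry m k a}

/-- A form on the sphere vanishes (as an alternating tensor on the tangent space)
at every point of `S^{m-1} ∩ Γ`, where `Γ = ∪ᵢ {uᵢ = 0}`. -/
def zeroOnGammaSph (m k : ℕ) (α : FormOn m (sphereSet m) k) : Prop :=
  ∀ u : sphereSet m, (∃ i, u.1 i = 0) →
    ∀ v : Fin k → Vec m, (∀ j, ∑ l, u.1 l * v j l = 0) → α u v = 0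

/-- An ambient form vanishes (as an alternating tensor) at every point of `Γ`. -/
def zeroOnGammaAmb (m k : ℕ) (α : Form m k) : Prop :=
  ∀ u : Vec m, (∃ i, u i = 0) → α u = 0

/-- The wedge product of forms on a subset. -/
def wedgeOn {m : ℕ} {M : Set (Vec m)} {k l : ℕ} (a : FormOn m M k) (b : FormOn m M l) :
    FormOn m M (k + l) :=
  fun x => wedgeAlt (a x) (b x)

/-- The base region of the parametrization of the simplex. -/
def baseSimplex (n : ℕ) : Set (Fin n → ℝ) := {y | (∀ j, 0 ≤ y j) ∧ ∑ j, y j ≤ 1}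

/-- Parametrization `y ↦ (1 - Σy, y)` of `T^n` over the base region. -/
def simplexParam (n : ℕ) (y : Fin n → ℝ) : Vec (n + 1) := Fin.cons (1 - ∑ j, y j) y

lemma simplexParam_mem {n : ℕ} {y : Fin n → ℝ} (h : y ∈ baseSimplex n) :
    simplexParam n y ∈ simplexSet (n + 1) := by
  constructor
  · intro i
    refine Fin.cases ?_ ?_ i
    · simpa [simplexParam] using sub_nonneg.mpr h.2
    · intro j; simpa [simplexParam] using h.1 j
  · simp [simplexParam, Fin.sum_cons]

/-- The coordinate tangent vectors `∂x/∂y_j = e_{j+1} - e_0` of the parametrization,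
a positively oriented frame for the orientation of `T^n` induced from the outward-normal
orientation of `S^n` via `Φ`. -/
def simplexTangent (n : ℕ) (j : Fin n) : Vec (n + 1) :=
  Fin.cons (-1) (Pi.single j 1)

open Classical in
/-- The integral of an `n`-form over the oriented simplex `T^n`. -/
def integralSimplex (n : ℕ) (ω : FormOn (n + 1) (simplexSet (n + 1)) n) : ℝ :=
  ∫ y : Fin n → ℝ,
    if h : y ∈ baseSimplex n then ω ⟨simplexParam n y, simplexParam_mem h⟩ (simplexTangent n)
    else 0

/-- Forms on a subset that genuinely are pullbacks to the simplex: they vanish in the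
normal directions (canonical representatives). -/
def TangentialSim (m k : ℕ) (a : FormOn m (simplexSet m) k) : Prop :=
  ∀ x, (a x).compLinearMap (projSim m) = a x

/-- Continuity of a form on a subset. -/
def ContFormOn (m : ℕ) (M : Set (Vec m)) (k : ℕ) (a : FormOn m M k) : Prop :=
  ∀ v : Fin k → Vec m, Continuous fun x : M => a x v

/-- The Riemannian volume form of the round sphere `S^{m-1}` (outward-normal orientation),
i.e. the restriction of `⋆_{ℝ^m} ν`. -/
def volSph (m : ℕ) : FormOn m (sphereSet m) (m - 1) :=
  fun u => (starAlt m 1 (nuForm m u.1)).compLinearMap (projSph m u.1)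



lemma degLE_add {m : ℕ} {r : ℤ} {p q : MvPolynomial (Fin m) ℝ} (hp : degLE r p)
    (hq : degLE r q) : degLE r (p + q) := fun d hd => by
  classical
  rcases Finset.mem_union.mp (MvPolynomial.support_add hd) with h | h
  exacts [hp d h, hq d h]

lemma degLE_smul {m : ℕ} {r : ℤ} {p : MvPolynomial (Fin m) ℝ} (c : ℝ) (hp : degLE r p) :
    degLE r (c • p) := fun d hd => hp d (MvPolynomial.support_smul hd)

/-- A linear functional applied to a polynomial form is a polynomial of the same degree bound. -/
lemma exists_poly_of_mem_PL {m k : ℕ} {r : ℤ} {α : Form m k} (hα : α ∈ PL m k r)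
    (L : (Vec m [⋀^Fin k]→ₗ[ℝ] ℝ) →ₗ[ℝ] ℝ) :
    ∃ p : MvPolynomial (Fin m) ℝ, degLE r p ∧ ∀ x, L (α x) = MvPolynomial.eval x p := by
  let ev : (Fin k → Fin m) → (Vec m [⋀^Fin k]→ₗ[ℝ] ℝ) →ₗ[ℝ] ℝ := fun g =>
    { toFun := fun a => a fun i => Pi.single (g i) 1
      map_add' := fun _ _ => rfl
      map_smul' := fun _ _ => rfl }
  have hL : L ∈ Submodule.span ℝ (Set.range ev) := by
    apply mem_span_of_iInf_ker_le_ker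
    intro a ha
    have : a = 0 := by
      apply (Pi.basisFun ℝ (Fin m)).ext_alternating
      intro g _
      have := (Submodule.mem_iInf _).mp ha g
      simpa [ev] using this
    simp [this]
  induction hL using Submodule.span_induction with
  | mem L h =>
    obtain ⟨g, rfl⟩ := h
    exact hα _
  | zero => exact ⟨0, by simp [degLE], by simp⟩
  | add L₁ L₂ _ _ h₁ h₂ =>
    obtain ⟨p, hp, hp'⟩ := h₁
    obtain ⟨q, hq, hq'⟩ := h₂
    exact ⟨p + q, degLE_add hp hq, by simp [hp', hq']⟩
  | smul c L _ h =>
    obtain ⟨p, hp, hp'⟩ := h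
    exact ⟨c • p, degLE_smul c hp, by simp [hp']⟩

lemma map_mem_PL {m k l : ℕ} {r : ℤ} {α : Form m k} (hα : α ∈ PL m k r)
    (T : (Vec m [⋀^Fin k]→ₗ[ℝ] ℝ) →ₗ[ℝ] (Vec m [⋀^Fin l]→ₗ[ℝ] ℝ)) :
    (fun x => T (α x)) ∈ PL m l r := fun v =>
  exists_poly_of_mem_PL hα
    { toFun := fun a => T a v
      map_add' := fun _ _ => by simp
      map_smul' := fun _ _ => by simp }

lemma contrMany_apply {m j : ℕ} : ∀ (k : ℕ) (v : Fin k → Vec m)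
    (α : Vec m [⋀^Fin (k + j)]→ₗ[ℝ] ℝ) (w : Fin j → Vec m),
    contrMany k v α w = α (Fin.append v w)
  | 0, v, α, w => by
    rw [contrMany, Fin.append_left_nil _ _ rfl]
    rfl
  | k + 1, v, α, w => by
    obtain ⟨a, v, rfl⟩ : ∃ a v', v = Fin.cons a v' := ⟨_, _, (Fin.cons_self_tail v).symm⟩
    rw [contrMany, contrMany_apply, Fin.append_cons]
    rfl

lemma append_eq_sumElim {X : Type*} {p q : ℕ} (a : Fin p → X) (b : Fin q → X) :
    Fin.append a b = Sum.elim a b ∘ finSumFinEquiv.symm := by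
  rw [← Fin.append_comp_sumElim, Function.comp_assoc]
  funext i
  refine Fin.addCases (fun i => ?_) (fun i => ?_) i <;> simp

/-- The volume form of `ℝ^m` with its slots split into two groups. -/
def splitVol {m p q : ℕ} (h : p + q = m) : Vec m [⋀^Fin p ⊕ Fin q]→ₗ[ℝ] ℝ :=
  (volForm m).domDomCongr ((finCongr h.symm).trans finSumFinEquiv.symm)

lemma starAlt_apply {m p q : ℕ} (h : p + q = m) (hq : m - p = q) (α : Vec m [⋀^Fin p]→ₗ[ℝ] ℝ)
    (w : Fin q → Vec m) :
    starAlt m p α (w ∘ finCongr hq) = (p.factorial : ℝ)⁻¹ *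
      ∑ g : Fin p → Fin m, α (fun i => Pi.single (g i) 1) *
        splitVol h (Sum.elim (fun i => Pi.single (g i) 1) w) := by
  subst hq
  rw [starAlt, dif_pos (by omega)]
  let ev : (Vec m [⋀^Fin (m - p)]→ₗ[ℝ] ℝ) →+ ℝ :=
    { toFun := fun a => a w
      map_zero' := rfl
      map_add' := fun _ _ => rfl }
  refine congrArg (_ * ·) ((map_sum ev _ _).trans (Finset.sum_congr rfl fun g _ => ?_))
  refine congrArg (_ * ·) ((contrMany_apply _ _ _ _).trans ?_)
  rw [append_eq_sumElim]
  rfl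

lemma splitVol_ne_zero {m p q : ℕ} (h : p + q = m) {f : Fin p ⊕ Fin q → Fin m}
    (hf : Function.Injective f) : splitVol h (fun i => Pi.single (f i) 1) ≠ 0 := by
  let e : Fin m ≃ Fin p ⊕ Fin q := (finCongr h.symm).trans finSumFinEquiv.symm
  let σ : Equiv.Perm (Fin m) := Equiv.ofBijective (f ∘ e)
    (Finite.injective_iff_bijective.mp (hf.comp e.injective))
  have : splitVol h (fun i => Pi.single (f i) 1) = volForm m (Pi.basisFun ℝ (Fin m) ∘ σ) := by
    rw [splitVol, AlternatingMap.domDomCongr_apply]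
    congr 1
    funext i
    simp [σ, e]
  rw [this, AlternatingMap.map_perm, volForm, Module.Basis.det_self]
  rcases Int.units_eq_one_or (Equiv.Perm.sign σ) with hs | hs <;> simp [hs]

instance (m k : ℕ) : FiniteDimensional ℝ (Vec m [⋀^Fin k]→ₗ[ℝ] ℝ) :=
  Module.Finite.of_injective
    ({ toFun := fun a => (a : MultilinearMap ℝ (fun _ : Fin k => Vec m) ℝ)
       map_add' := fun _ _ => rfl
       map_smul' := fun _ _ => rfl } :
      (Vec m [⋀^Fin k]→ₗ[ℝ] ℝ) →ₗ[ℝ] MultilinearMap ℝ (fun _ : Fin k => Vec m) ℝ)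
    AlternatingMap.coe_multilinearMap_injective

/-- The Hodge star as a linear map between complementary degrees. -/
def starLin {m p q : ℕ} (h : p + q = m) :
    (Vec m [⋀^Fin p]→ₗ[ℝ] ℝ) →ₗ[ℝ] (Vec m [⋀^Fin q]→ₗ[ℝ] ℝ) where
  toFun α := (starAlt m p α).domDomCongr (finCongr (by omega))
  map_add' α β := by
    ext w
    simp [starAlt, dif_pos (show p ≤ m by omega), add_smul, Finset.sum_add_distrib]
  map_smul' c α := by
    ext w
    simp [starAlt, dif_pos (show p ≤ m by omega), mul_smul, ← Finset.smul_sum, mul_left_comm]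

lemma starLin_apply {m p q : ℕ} (h : p + q = m) (α : Vec m [⋀^Fin p]→ₗ[ℝ] ℝ)
    (w : Fin q → Vec m) :
    starLin h α w = (p.factorial : ℝ)⁻¹ *
      ∑ g : Fin p → Fin m, α (fun i => Pi.single (g i) 1) *
        splitVol h (Sum.elim (fun i => Pi.single (g i) 1) w) :=
  starAlt_apply h (by omega) α w

lemma exists_complement {m p q : ℕ} (h : p + q = m) {g : Fin p → Fin m}
    (hg : Function.Injective g) : ∃ f : Fin q → Fin m, Function.Injective (Sum.elim g f) := by
  have hc : ((Finset.univ.image g)ᶜ).card = q := by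
    rw [Finset.card_compl, Finset.card_image_of_injective _ hg]
    simp only [Finset.card_univ, Fintype.card_fin]
    omega
  refine ⟨(Finset.univ.image g)ᶜ.orderEmbOfFin hc,
    hg.sumElim (RelEmbedding.injective _) fun a b hab => ?_⟩
  have := Finset.orderEmbOfFin_mem _ hc b
  rw [← hab] at this
  simp at this

/-- Two products `α(e_g) vol(e_g, e_f)` with the same complementary index `f` have the same
sign. -/
lemma mul_splitVol_nonneg {m p q : ℕ} (h : p + q = m) (α : Vec m [⋀^Fin p]→ₗ[ℝ] ℝ)
    {g₀ : Fin p → Fin m} {f : Fin q → Fin m} (hf : Function.Injective (Sum.elim g₀ f))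
    (g : Fin p → Fin m) :
    0 ≤ (α (fun i => Pi.single (g i) 1) *
          splitVol h (Sum.elim (fun i => Pi.single (g i) 1) fun i => Pi.single (f i) 1)) *
        (α (fun i => Pi.single (g₀ i) 1) *
          splitVol h (Sum.elim (fun i => Pi.single (g₀ i) 1) fun i => Pi.single (f i) 1)) := by
  by_cases hg : Function.Injective (Sum.elim g f)
  · have hsurj : Function.Surjective (Sum.elim g₀ f) :=
      (hf.bijective_of_nat_card_le (by simp [h])).2
    have key : ∀ i, ∃ j, g₀ j = g i := fun i => by
      obtain ⟨j | j, hj⟩ := hsurj (g i)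
      · exact ⟨j, hj⟩
      · have := @hg (Sum.inr j) (Sum.inl i) (by simpa using hj)
        simp at this
    choose τ hτ using key
    have hτi : Function.Injective τ := fun a b hab => by
      have : g a = g b := by rw [← hτ a, ← hτ b, hab]
      simpa using @hg (Sum.inl a) (Sum.inl b) (by simpa using this)
    let σ : Equiv.Perm (Fin p) := Equiv.ofBijective τ (Finite.injective_iff_bijective.mp hτi)
    have h₁ : (fun i => (Pi.single (g i) 1 : Vec m)) =
        (fun i => Pi.single (g₀ i) 1) ∘ σ := by
      funext i
      simp [σ, hτ]
    have h₂ : Sum.elim ((fun i => (Pi.single (g₀ i) 1 : Vec m)) ∘ σ)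
          (fun i => (Pi.single (f i) 1 : Vec m)) =
        Sum.elim (fun i => Pi.single (g₀ i) 1) (fun i => Pi.single (f i) 1) ∘
          (Equiv.sumCongr σ (Equiv.refl _)) := by
      funext i
      rcases i with i | i <;> simp
    rw [h₁, h₂, AlternatingMap.map_perm, AlternatingMap.map_perm, Equiv.Perm.sign_sumCongr]
    rcases Int.units_eq_one_or (Equiv.Perm.sign σ) with hs | hs <;> simp [hs] <;>
      exact mul_self_nonneg _
  · simp only [Function.Injective, not_forall] at hg
    obtain ⟨a, b, hab, hne⟩ := hg
    rw [AlternatingMap.map_eq_zero_of_eq (splitVol h)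
      (Sum.elim (fun i => Pi.single (g i) 1) fun i => Pi.single (f i) 1) (i := a) (j := b) ?_ hne]
    · simp
    · rcases a with a | a <;> rcases b with b | b <;> simp_all

lemma starLin_injective {m p q : ℕ} (h : p + q = m) : Function.Injective (starLin h) := by
  rw [injective_iff_map_eq_zero]
  intro α hα
  refine (Pi.basisFun ℝ (Fin m)).ext_alternating fun g₀ hg₀ => ?_
  obtain ⟨f, hf⟩ := exists_complement h hg₀
  have h₀ := congrArg (fun β => β fun i => (Pi.single (f i) 1 : Vec m)) hα
  simp only [starLin_apply, AlternatingMap.zero_apply, mul_eq_zero, inv_eq_zero,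
    Nat.cast_eq_zero, Nat.factorial_ne_zero, false_or] at h₀
  have h₁ := congrArg (· * (α (fun i => Pi.single (g₀ i) 1) *
    splitVol h (Sum.elim (fun i => Pi.single (g₀ i) 1) fun i => Pi.single (f i) 1))) h₀
  simp only [Finset.sum_mul, zero_mul] at h₁
  rw [Finset.sum_eq_zero_iff_of_nonneg fun g _ => mul_splitVol_nonneg h α hf g] at h₁
  have h₂ := mul_self_eq_zero.mp (h₁ g₀ (Finset.mem_univ _))
  have h₃ := splitVol_ne_zero h hf
  rw [show (fun i => (Pi.single (Sum.elim g₀ f i) 1 : Vec m)) =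
    Sum.elim (fun i => Pi.single (g₀ i) 1) fun i => Pi.single (f i) 1 by
      funext i; rcases i with i | i <;> rfl] at h₃
  simpa [h₃] using h₂

lemma starLin_bijective {m p q : ℕ} (h : p + q = m) : Function.Bijective (starLin h) := by
  have h₁ := LinearMap.finrank_le_finrank_of_injective (starLin_injective h)
  have h₂ := LinearMap.finrank_le_finrank_of_injective
    (starLin_injective (show q + p = m by omega))
  exact ⟨starLin_injective h, (LinearMap.injective_iff_surjective_of_finrank_eq_finrank
    (le_antisymm h₁ h₂)).mp (starLin_injective h)⟩

/-- Summing over basis tuples, a symmetric endomorphism can be moved from one multilinear map to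
another. -/
lemma sum_map_symm {m l : ℕ} (A B : MultilinearMap ℝ (fun _ : Fin l => Vec m) ℝ)
    (P : Vec m →ₗ[ℝ] Vec m)
    (hP : ∀ i j, P (Pi.single i 1) j = P (Pi.single j 1) i) :
    ∑ g : Fin l → Fin m, A (fun i => P (Pi.single (g i) 1)) * B (fun i => Pi.single (g i) 1) =
      ∑ g : Fin l → Fin m, A (fun i => Pi.single (g i) 1) *
        B (fun i => P (Pi.single (g i) 1)) := by
  have expand : ∀ (C : MultilinearMap ℝ (fun _ : Fin l => Vec m) ℝ) (g : Fin l → Fin m),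
      C (fun i => P (Pi.single (g i) 1)) =
        ∑ f : Fin l → Fin m, (∏ i, P (Pi.single (g i) 1) (f i)) *
          C (fun i => Pi.single (f i) 1) := by
    intro C g
    have : (fun i => P (Pi.single (g i) 1)) = fun i => ∑ j : Fin m,
        P (Pi.single (g i) 1) j • (Pi.single j 1 : Vec m) := by
      funext i
      exact pi_eq_sum_univ' _
    rw [this, MultilinearMap.map_sum]
    simp only [MultilinearMap.map_smul_univ, smul_eq_mul]
  simp only [expand, Finset.sum_mul, Finset.mul_sum]
  rw [Finset.sum_comm]
  refine Finset.sum_congr rfl fun f _ => Finset.sum_congr rfl fun g _ => ?_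
  simp only [fun i => hP (g i) (f i)]
  ring

lemma projSph_single_symm {m : ℕ} (u : Vec m) (i j : Fin m) :
    projSph m u (Pi.single i 1) j = projSph m u (Pi.single j 1) i := by
  simp [projSph, dotLin, Pi.single_apply, eq_comm, mul_comm]

/-- Against an alternating map, summing the tensor product is the same as summing the
wedge product, up to the number of permutations. -/
lemma sum_wedgeAlt {m l q : ℕ} (a : Vec m [⋀^Fin 1]→ₗ[ℝ] ℝ) (b : Vec m [⋀^Fin l]→ₗ[ℝ] ℝ)
    (D : Vec m [⋀^(Fin 1 ⊕ Fin l) ⊕ Fin q]→ₗ[ℝ] ℝ) (w : Fin q → Vec m) :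
    (l.factorial : ℝ) * ∑ g : Fin 1 ⊕ Fin l → Fin m,
      wedgeAlt a b ((fun i => Pi.single (g i) 1) ∘ finSumFinEquiv.symm) *
        D (Sum.elim (fun i => Pi.single (g i) 1) w) =
    ((1 + l).factorial : ℝ) * ∑ g : Fin 1 ⊕ Fin l → Fin m,
      (a (fun i => Pi.single (g (Sum.inl i)) 1) * b (fun i => Pi.single (g (Sum.inr i)) 1)) *
        D (Sum.elim (fun i => Pi.single (g i) 1) w) := by
  have hw : ∀ v : Fin 1 ⊕ Fin l → Vec m,
      (l.factorial : ℝ) * wedgeAlt a b (v ∘ finSumFinEquiv.symm) =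
        ∑ σ : Equiv.Perm (Fin 1 ⊕ Fin l), ((Equiv.Perm.sign σ : ℤ) : ℝ) *
          (a (fun i => v (σ (Sum.inl i))) * b (fun i => v (σ (Sum.inr i)))) := by
    intro v
    have := congrArg (fun T => TensorProduct.lid ℝ ℝ (T v))
      (MultilinearMap.domCoprod_alternization_eq a b)
    simp only [MultilinearMap.alternatization_apply, Fintype.card_fin, Nat.factorial_one, one_mul,
      AlternatingMap.smul_apply, map_nsmul, map_sum] at this
    rw [wedgeAlt, AlternatingMap.domDomCongr_apply, Function.comp_assoc,
      Equiv.symm_comp_self, Function.comp_id]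
    rw [nsmul_eq_mul] at this
    refine this.symm.trans (Finset.sum_congr rfl fun σ _ => ?_)
    rcases Int.units_eq_one_or (Equiv.Perm.sign σ) with hs | hs <;>
      simp [hs, MultilinearMap.domCoprod_apply]
  simp only [Finset.mul_sum, ← mul_assoc, hw, Finset.sum_mul]
  rw [Finset.sum_comm]
  have hσ : ∀ σ : Equiv.Perm (Fin 1 ⊕ Fin l), ∑ g : Fin 1 ⊕ Fin l → Fin m,
      ((Equiv.Perm.sign σ : ℤ) : ℝ) * a (fun i => Pi.single (g (σ (Sum.inl i))) 1) *
        b (fun i => Pi.single (g (σ (Sum.inr i))) 1) *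
        D (Sum.elim (fun i => Pi.single (g i) 1) w) =
      ∑ g : Fin 1 ⊕ Fin l → Fin m, a (fun i => Pi.single (g (Sum.inl i)) 1) *
        b (fun i => Pi.single (g (Sum.inr i)) 1) *
        D (Sum.elim (fun i => Pi.single (g i) 1) w) := by
    intro σ
    refine Fintype.sum_equiv (Equiv.arrowCongr σ.symm (Equiv.refl _)) _ _ fun g => ?_
    have h₂ : Sum.elim (fun i => (Pi.single (g (σ i)) 1 : Vec m)) w =
        Sum.elim (fun i => Pi.single (g i) 1) w ∘ (Equiv.sumCongr σ (Equiv.refl _)) := by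
      funext i
      rcases i with i | i <;> simp
    simp only [Equiv.arrowCongr_apply, Equiv.coe_refl, Equiv.symm_symm, Function.comp_apply, id]
    rw [h₂, AlternatingMap.map_perm, Equiv.Perm.sign_sumCongr]
    rcases Int.units_eq_one_or (Equiv.Perm.sign σ) with hs | hs <;> simp [hs]
  refine (Finset.sum_congr rfl fun σ _ => hσ σ).trans ?_
  simp only [Finset.sum_const, Finset.card_univ, Fintype.card_perm, Fintype.card_sum,
    Fintype.card_fin, nsmul_eq_mul, Finset.mul_sum, mul_assoc]

lemma volForm_eq_det {m : ℕ} (v : Fin m → Vec m) : volForm m v = (Matrix.of v).det := by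
  rw [volForm, Pi.basisFun_det]
  rfl

/-- The volume form on `1 + l + k` slots, grouped as a vector, `l` vectors and `k` vectors. -/
def splitVol₃ {m l k : ℕ} (h : 1 + l + k = m) : Vec m [⋀^(Fin 1 ⊕ Fin l) ⊕ Fin k]→ₗ[ℝ] ℝ :=
  (splitVol h).domDomCongr (Equiv.sumCongr finSumFinEquiv.symm (Equiv.refl _))

/-- Moving the first vector past the next `l` ones changes the volume form by a sign. -/
lemma splitVol₃_eq {m l k : ℕ} (h : 1 + l + k = m) (h' : l + (k + 1) = m) :
    ∃ ε : ℝ, ε ≠ 0 ∧ ∀ (u : Vec m) (v : Fin l → Vec m) (w : Fin k → Vec m),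
      splitVol₃ h (Sum.elim (Sum.elim (fun _ => u) v) w) =
        ε * splitVol h' (Sum.elim v (Fin.cons u w)) := by
  let E₁ : Fin m ≃ (Fin 1 ⊕ Fin l) ⊕ Fin k :=
    ((finCongr h.symm).trans finSumFinEquiv.symm).trans
      (Equiv.sumCongr finSumFinEquiv.symm (Equiv.refl _))
  let E₂ : Fin m ≃ Fin l ⊕ Fin (k + 1) := (finCongr h'.symm).trans finSumFinEquiv.symm
  let J : (Fin 1 ⊕ Fin l) ⊕ Fin k ≃ Fin l ⊕ Fin (k + 1) :=
    ((Equiv.sumCongr (Equiv.sumComm _ _) (Equiv.refl _)).trans (Equiv.sumAssoc _ _ _)).trans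
      (Equiv.sumCongr (Equiv.refl _) (finSumFinEquiv.trans (finCongr (Nat.add_comm 1 k))))
  let σ : Equiv.Perm (Fin m) := (E₁.trans J).trans E₂.symm
  refine ⟨((Equiv.Perm.sign σ : ℤ) : ℝ), by simp, fun u v w => ?_⟩
  have hJ : Sum.elim (Sum.elim (fun _ => u) v) w = Sum.elim v (Fin.cons u w) ∘ J := by
    funext i
    rcases i with (i | i) | i
    · have : Fin.cast (Nat.add_comm 1 k) (Fin.castAdd k i) = 0 := by
        ext; simp
      simp [J, this]
    · simp [J]
    · have : Fin.cast (Nat.add_comm 1 k) (Fin.natAdd 1 i) = i.succ := by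
        ext; simp
      simp [J, this]
  have hE : splitVol₃ h (Sum.elim (Sum.elim (fun _ => u) v) w) =
      volForm m ((Sum.elim v (Fin.cons u w) ∘ E₂) ∘ σ) := by
    rw [hJ]
    have : (Sum.elim v (Fin.cons u w : Fin (k + 1) → Vec m) ∘ E₂) ∘ σ =
        (Sum.elim v (Fin.cons u w) ∘ J) ∘ E₁ := by
      funext i
      simp only [σ, Function.comp_apply, Equiv.trans_apply, Equiv.apply_symm_apply]
    rw [this]
    rfl
  rw [hE, AlternatingMap.map_perm, Units.smul_def, zsmul_eq_mul]
  rfl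

/-- Slots of `splitVol₃` may be projected orthogonally to the vector in the first slot. -/
lemma splitVol₃_projSph {m l k : ℕ} (h : 1 + l + k = m) (u : Vec m) (v : Fin l → Vec m)
    (w : Fin k → Vec m) :
    splitVol₃ h (Sum.elim (Sum.elim (fun _ => u) fun i => projSph m u (v i)) w) =
      splitVol₃ h (Sum.elim (Sum.elim (fun _ => u) v) w) := by
  let E : Fin m ≃ (Fin 1 ⊕ Fin l) ⊕ Fin k :=
    ((finCongr h.symm).trans finSumFinEquiv.symm).trans
      (Equiv.sumCongr finSumFinEquiv.symm (Equiv.refl _))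
  have hD : ∀ x, splitVol₃ h x = (Matrix.of (x ∘ E)).det := fun x => volForm_eq_det _
  rw [hD, hD]
  refine Matrix.det_eq_of_forall_row_eq_smul_add_const
    (Sum.elim (Sum.elim (fun _ => 0) fun i => -dotLin m u (v i)) (fun _ => 0) ∘ E)
    (E.symm (Sum.inl (Sum.inl 0))) (by simp) fun i j => ?_
  simp only [Matrix.of_apply, Function.comp_apply, Equiv.apply_symm_apply, Sum.elim_inl]
  rcases E i with (a | a) | a <;> simp [projSph, sub_eq_add_neg]

/-- The pointwise formula `⋆(ν ∧ α) = ± i_u (⋆α)`, where `α` may be replaced by its tangential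
part. -/
lemma starAlt_wedgeAlt_nuForm {m l k : ℕ} (h : 1 + l + k = m) (hq : m - (1 + l) = k) (u : Vec m)
    (α : Vec m [⋀^Fin l]→ₗ[ℝ] ℝ) (w : Fin k → Vec m) :
    starAlt m (1 + l) (wedgeAlt (nuForm m u) (α.compLinearMap (projSph m u)))
        (w ∘ finCongr hq) =
      (l.factorial : ℝ)⁻¹ * ∑ g : Fin l → Fin m, α (fun i => Pi.single (g i) 1) *
        splitVol₃ h (Sum.elim (Sum.elim (fun _ => u) fun i => Pi.single (g i) 1) w) := by
  set α' := α.compLinearMap (projSph m u)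
  let B : MultilinearMap ℝ (fun _ : Fin l => Vec m) ℝ :=
    { toFun := fun v => splitVol₃ h (Sum.elim (Sum.elim (fun _ => u) v) w)
      map_update_add' := fun v i x y => by
        simp only [← Sum.update_elim_inr, ← Sum.update_elim_inl, AlternatingMap.map_update_add]
      map_update_smul' := fun v i c x => by
        simp only [← Sum.update_elim_inr, ← Sum.update_elim_inl,
          AlternatingMap.map_update_smul] }
  have hB : ∀ v, B v = splitVol₃ h (Sum.elim (Sum.elim (fun _ => u) v) w) := fun _ => rfl
  have hν : ∀ v : Fin l → Vec m, ∑ a : Fin 1 → Fin m,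
      nuForm m u (fun i => Pi.single (a i) 1) *
        splitVol₃ h (Sum.elim (Sum.elim (fun i => Pi.single (a i) 1) v) w) = B v := by
    intro v
    let φ : Vec m →ₗ[ℝ] ℝ := (splitVol₃ h).toMultilinearMap.toLinearMap
      (Sum.elim (Sum.elim (fun _ => u) v) w) (Sum.inl (Sum.inl 0))
    have hφ : ∀ x, φ x = splitVol₃ h (Sum.elim (Sum.elim (fun _ => x) v) w) := by
      intro x
      have : Function.update (Sum.elim (Sum.elim (fun _ => u) v) w) (Sum.inl (Sum.inl 0)) x =
          Sum.elim (Sum.elim (fun _ : Fin 1 => x) v) w := by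
        rw [Sum.update_elim_inl, Sum.update_elim_inl]
        congr 2
        funext i
        simp [Subsingleton.elim i 0]
      rw [← this]
      rfl
    rw [hB, ← hφ, pi_eq_sum_univ' u, map_sum]
    refine Fintype.sum_equiv (Equiv.funUnique (Fin 1) (Fin m)) _ _ fun a => ?_
    have ha : (fun i => (Pi.single (a i) 1 : Vec m)) = fun _ => Pi.single (a 0) 1 := by
      funext i
      rw [Subsingleton.elim i 0]
    rw [ha, map_smul, hφ]
    simp [nuForm, dotLin, Pi.single_apply]
  have hsum := sum_map_symm α.toMultilinearMap B (projSph m u) (projSph_single_symm u)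
  simp only [hB, splitVol₃_projSph] at hsum
  have hl : ((1 + l).factorial : ℝ) ≠ 0 := by exact_mod_cast Nat.factorial_ne_zero _
  have hl' : (l.factorial : ℝ) ≠ 0 := by exact_mod_cast Nat.factorial_ne_zero _
  have hreindex : ∑ g : Fin (1 + l) → Fin m, wedgeAlt (nuForm m u) α'
        (fun i => Pi.single (g i) 1) * splitVol h (Sum.elim (fun i => Pi.single (g i) 1) w) =
      ∑ g : Fin 1 ⊕ Fin l → Fin m,
        wedgeAlt (nuForm m u) α' ((fun i => Pi.single (g i) 1) ∘ finSumFinEquiv.symm) *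
          splitVol₃ h (Sum.elim (fun i => Pi.single (g i) 1) w) := by
    refine Fintype.sum_equiv (Equiv.arrowCongr finSumFinEquiv.symm (Equiv.refl _)) _ _ fun g => ?_
    refine congrArg₂ (· * ·) (congrArg _ ?_) (congrArg (splitVol h) ?_)
    · funext i
      simp
    · funext i
      rcases i with i | i <;> simp
  have hsplit : ∑ g : Fin 1 ⊕ Fin l → Fin m,
      (nuForm m u (fun i => Pi.single (g (Sum.inl i)) 1) *
        α' (fun i => Pi.single (g (Sum.inr i)) 1)) *
        splitVol₃ h (Sum.elim (fun i => Pi.single (g i) 1) w) =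
      ∑ g : Fin l → Fin m, α' (fun i => Pi.single (g i) 1) *
        B (fun i => Pi.single (g i) 1) := by
    simp only [← hν, Finset.mul_sum]
    rw [Finset.sum_comm, ← Fintype.sum_prod_type']
    refine Fintype.sum_equiv (Equiv.sumArrowEquivProdArrow _ _ _) _ _ fun g => ?_
    have : (fun i => (Pi.single (g i) 1 : Vec m)) =
        Sum.elim (fun i => Pi.single (g (Sum.inl i)) 1) fun i => Pi.single (g (Sum.inr i)) 1 := by
      funext i
      rcases i with i | i <;> rfl
    rw [this]
    simp only [Equiv.sumArrowEquivProdArrow, Equiv.coe_fn_mk, Function.comp_apply]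
    ring
  have hwedge := sum_wedgeAlt (nuForm m u) α' (splitVol₃ h) w
  rw [hsplit] at hwedge
  rw [starAlt_apply h hq, hreindex, inv_mul_eq_iff_eq_mul₀ hl, mul_left_comm,
    eq_inv_mul_iff_mul_eq₀ hl', hwedge]
  exact congrArg _ hsum

/-- On the sphere, `⋆_S α` is a nonzero multiple of the restriction of `i_X ⋆α`. -/
lemma exists_castFormOn_starSph_eq {m l k : ℕ} (h : 1 + l + k = m) (h' : l + (k + 1) = m) :
    ∃ ε : ℝ, ε ≠ 0 ∧ ∀ (hq : m - (1 + l) = k) (γ : Form m l),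
      castFormOn hq (starSph m l (resSph m l γ)) =
        resSph m k (iU fun x => (ε • starLin h') (γ x)) := by
  obtain ⟨ε, hε, hv⟩ := splitVol₃_eq h h'
  refine ⟨ε, hε, fun hq γ => ?_⟩
  funext u
  ext w
  refine (starAlt_wedgeAlt_nuForm h hq u.1 (γ u.1) fun i => projSph m u.1 (w i)).trans ?_
  simp only [hv]
  change _ = ε * starLin h' (γ u.1) (Fin.cons u.1 fun i => projSph m u.1 (w i))
  rw [starLin_apply, Finset.mul_sum, Finset.mul_sum, Finset.mul_sum]
  refine Finset.sum_congr rfl fun g _ => ?_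
  ring

theorem stmt13 (n k s : ℕ) (hn : 1 ≤ n) (hk : k ≤ n) (hs : 1 ≤ s) :
    PLmsph (n + 1) k (s : ℤ) =
      (fun γ => castFormOn (show (n + 1) - (1 + (n - k)) = k by omega)
        (starSph (n + 1) (n - k) γ)) '' PLsph (n + 1) (n - k) ((s : ℤ) - 1) := by
  have h' : n - k + (k + 1) = n + 1 := by omega
  obtain ⟨ε, hε, hstar⟩ := exists_castFormOn_starSph_eq (show 1 + (n - k) + k = n + 1 by omega) h'
  apply Set.Subset.antisymm
  · rintro _ ⟨_, ⟨β, hβ, rfl⟩, rfl⟩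
    let S := LinearEquiv.ofBijective (starLin h') (starLin_bijective h')
    refine ⟨_, ⟨_, map_mem_PL hβ (ε⁻¹ • S.symm.toLinearMap), rfl⟩, ?_⟩
    refine (hstar _ _).trans ?_
    congr 2
    funext x
    have : starLin h' (S.symm (β x)) = β x := S.apply_symm_apply (β x)
    simp [this, smul_smul, hε]
  · rintro _ ⟨_, ⟨γ, hγ, rfl⟩, rfl⟩
    exact ⟨_, ⟨_, map_mem_PL hγ (ε • starLin h'), rfl⟩, (hstar _ γ).symm⟩

end
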